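/- arXiv:2307.14085 — 2 statements merged into one kernel-verified Lean document; each statement's English description precedes it below -/
import Mathlib

section
/- Upper bound on the total-variation distance between quantal responses. Let Q, Q̃ : B → ℝ with ν = ν_Q and ν̃ = ν_{Q̃}. Then for every ξ ∈ ℝ: D_TV(ν, ν̃) ≤ η·Σ_{b∈B} ν(b)·[ |Q̃(b) − Q(b) − ξ| + (η/2)·exp(η·|Q̃(b) − Q(b) − ξ|)·(Q̃(b) − Q(b) − ξ)² ]. In particular, taking ξ = V(Q̃) − V(Q) and writing A = A_Q, Ã = A_{Q̃}: D_TV(ν, ν̃) ≤ η·Σ_{b∈B} ν(b)·[ |Ã(b) − A(b)| + (η/2)·exp(η·|Ã(b) − A(b)|)·(Ã(b) − A(b))² ]. -/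
open Finset

noncomputable section

namespace QSE5

variable {B : Type*} [Fintype B]

/-- Soft value `V(Q) = η⁻¹ log Σ_b exp(η Q b)`. -/
def softVal (η : ℝ) (Q : B → ℝ) : ℝ := η⁻¹ * Real.log (∑ b, Real.exp (η * Q b))

/-- Advantage `A_Q(b) = Q b − V(Q)`. -/
def adv (η : ℝ) (Q : B → ℝ) (b : B) : ℝ := Q b - softVal η Q

/-- Quantal response `ν_Q(b) = exp(η A_Q(b))`. -/
def qres (η : ℝ) (Q : B → ℝ) (b : B) : ℝ := Real.exp (η * adv η Q b)

/-- Total-variation distance between (densities of) distributions on `B`. -/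
def dTV (p q : B → ℝ) : ℝ := (1 / 2) * ∑ b, |p b - q b|

theorem exp_aux (t : ℝ) (ht : 0 ≤ t) : Real.exp t - 1 ≤ t + t ^ 2 / 2 * Real.exp t := by
  have hd : ∀ x : ℝ, HasDerivAt (fun x : ℝ => Real.exp (-x) * (1 + x) + x ^ 2 / 2)
      (x * (1 - Real.exp (-x))) x := by
    intro x
    have h1 : HasDerivAt (fun x : ℝ => Real.exp (-x)) (Real.exp (-x) * (-1)) x :=
      (hasDerivAt_neg x).exp
    have h2 : HasDerivAt (fun x : ℝ => 1 + x) 1 x := (hasDerivAt_id x).const_add 1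
    have h3 : HasDerivAt (fun x : ℝ => x ^ 2 / 2) (2 * x / 2) x := by
      simpa using (hasDerivAt_pow 2 x).div_const 2
    exact ((h1.mul h2).add h3).congr_deriv (by ring)
  have hm : MonotoneOn (fun x : ℝ => Real.exp (-x) * (1 + x) + x ^ 2 / 2) (Set.Ici 0) := by
    apply monotoneOn_of_deriv_nonneg (convex_Ici 0)
    · exact fun x _ => (hd x).continuousAt.continuousWithinAt
    · exact fun x _ => (hd x).differentiableAt.differentiableWithinAt
    · intro x hx
      rw [interior_Ici] at hx
      have hx' : 0 < x := hx
      rw [(hd x).deriv]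
      have : Real.exp (-x) ≤ 1 := Real.exp_le_one_iff.mpr (by linarith)
      exact mul_nonneg hx'.le (by linarith)
  have h := hm (Set.mem_Ici.mpr le_rfl) (Set.mem_Ici.mpr ht) ht
  simp only [neg_zero, Real.exp_zero] at h
  have he : Real.exp t * Real.exp (-t) = 1 := by rw [← Real.exp_add]; simp
  have h' := mul_le_mul_of_nonneg_left h (Real.exp_pos t).le
  have e2 : Real.exp t * (Real.exp (-t) * (1 + t) + t ^ 2 / 2)
      = (1 + t) + Real.exp t * (t ^ 2 / 2) := by
    rw [mul_add, ← mul_assoc, he, one_mul]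
  rw [e2] at h'
  linarith

theorem abs_exp_aux (x : ℝ) : |Real.exp x - 1| ≤ |x| + x ^ 2 / 2 * Real.exp |x| := by
  have h := exp_aux |x| (abs_nonneg x)
  rw [sq_abs] at h
  refine le_trans ?_ h
  rw [abs_le]
  have h1 := Real.exp_le_exp.mpr (le_abs_self x)
  have h2 := Real.add_one_le_exp x
  have h3 := Real.add_one_le_exp |x|
  have h4 := neg_abs_le x
  constructor <;> linarith

theorem qres_sum [Nonempty B] (η : ℝ) (hη : 0 < η) (Q : B → ℝ) : ∑ b, qres η Q b = 1 := by
  have hS : 0 < ∑ b, Real.exp (η * Q b) :=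
    Finset.sum_pos (fun b _ => Real.exp_pos _) Finset.univ_nonempty
  have : ∀ b, qres η Q b = Real.exp (η * Q b) / ∑ b, Real.exp (η * Q b) := by
    intro b
    unfold qres adv softVal
    rw [mul_sub, ← mul_assoc, mul_inv_cancel₀ hη.ne', one_mul, Real.exp_sub, Real.exp_log hS]
  simp_rw [this]
  rw [← Finset.sum_div, div_self hS.ne']

theorem tv_main [Nonempty B] (η : ℝ) (hη : 0 < η) (Q Qt : B → ℝ) (ξ : ℝ) :
    dTV (qres η Q) (qres η Qt) ≤
        η * ∑ b, qres η Q b *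
          (|Qt b - Q b - ξ| +
            η / 2 * Real.exp (η * |Qt b - Q b - ξ|) * (Qt b - Q b - ξ) ^ 2) := by
  have h1 := qres_sum η hη Q
  have h2 := qres_sum η hη Qt
  -- the unnormalised measure is a constant multiple of the quantal response to `Qt`
  set c : ℝ := Real.exp (η * (softVal η Qt - softVal η Q - ξ)) with hc
  have hw : ∀ b, qres η Q b * Real.exp (η * (Qt b - Q b - ξ)) = c * qres η Qt b := by
    intro b
    rw [hc]
    unfold qres adv
    rw [← Real.exp_add, ← Real.exp_add]
    congr 1
    ring
  have hpos : ∀ b, 0 < qres η Q b := fun b => Real.exp_pos _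
  have hpos' : ∀ b, 0 < qres η Qt b := fun b => Real.exp_pos _
  set S : ℝ := ∑ b, |qres η Q b - c * qres η Qt b| with hS
  have hc1 : |1 - c| ≤ S := by
    have : 1 - c = ∑ b, (qres η Q b - c * qres η Qt b) := by
      rw [Finset.sum_sub_distrib, ← Finset.mul_sum, h1, h2, mul_one]
    rw [this]
    exact Finset.abs_sum_le_sum_abs _ _
  have htri : ∑ b, |qres η Q b - qres η Qt b| ≤ S + |1 - c| := by
    have : |1 - c| = ∑ b, |1 - c| * qres η Qt b := by rw [← Finset.mul_sum, h2, mul_one]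
    rw [this, hS, ← Finset.sum_add_distrib]
    apply Finset.sum_le_sum
    intro b _
    have e : |1 - c| * qres η Qt b = |c * qres η Qt b - qres η Qt b| := by
      rw [abs_sub_comm 1 c, ← abs_of_pos (hpos' b), ← abs_mul, abs_of_pos (hpos' b)]
      congr 1
      ring
    rw [e]
    exact abs_sub_le _ _ _
  have hfin : S ≤ η * ∑ b, qres η Q b *
          (|Qt b - Q b - ξ| +
            η / 2 * Real.exp (η * |Qt b - Q b - ξ|) * (Qt b - Q b - ξ) ^ 2) := by
    rw [hS, Finset.mul_sum]
    apply Finset.sum_le_sum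
    intro b _
    rw [← hw b]
    have h := abs_exp_aux (η * (Qt b - Q b - ξ))
    rw [abs_mul η, abs_of_pos hη] at h
    have e : |qres η Q b - qres η Q b * Real.exp (η * (Qt b - Q b - ξ))|
        = qres η Q b * |Real.exp (η * (Qt b - Q b - ξ)) - 1| := by
      rw [abs_sub_comm, ← mul_sub_one, abs_mul, abs_of_pos (hpos b)]
    rw [e]
    refine (mul_le_mul_of_nonneg_left h (hpos b).le).trans (le_of_eq ?_)
    ring
  unfold dTV
  linarith

/-- Upper bound on the TV distance between quantal responses: for every shift `ξ ∈ ℝ`,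
`D_TV(ν_Q, ν_{Q̃}) ≤ η Σ_b ν_Q(b)[|Q̃−Q−ξ| + (η/2) exp(η|Q̃−Q−ξ|)(Q̃−Q−ξ)²]`;
in particular (taking `ξ = V(Q̃) − V(Q)`) the same bound with advantages. -/
theorem tv_upper_bound_quantal
    {B : Type*} [Fintype B] [Nonempty B]
    (η : ℝ) (hη : 0 < η) (Q Qt : B → ℝ) :
    (∀ ξ : ℝ,
      dTV (qres η Q) (qres η Qt) ≤
        η * ∑ b, qres η Q b *
          (|Qt b - Q b - ξ| +
            η / 2 * Real.exp (η * |Qt b - Q b - ξ|) * (Qt b - Q b - ξ) ^ 2)) ∧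
    dTV (qres η Q) (qres η Qt) ≤
      η * ∑ b, qres η Q b *
        (|adv η Qt b - adv η Q b| +
          η / 2 * Real.exp (η * |adv η Qt b - adv η Q b|) * (adv η Qt b - adv η Q b) ^ 2) := by
  refine ⟨tv_main η hη Q Qt, ?_⟩
  have h := tv_main η hη Q Qt (softVal η Qt - softVal η Q)
  have e : ∀ b, adv η Qt b - adv η Q b = Qt b - Q b - (softVal η Qt - softVal η Q) := by
    intro b
    unfold adv
    ring
  simp only [e]
  exact h

end QSE5
end
end

section
/- Bounding the first-order quantal-response error. Fix a leader policy π with quantal response ν = ν^π, and suppose B_A > 0 satisfies ‖A_h^π‖_∞ ≤ B_A and ‖Ã_h‖_∞ ≤ B_A for all h = 1,…,H. Define Δ̃_h⁽¹⁾(s,b) = (E_{s,b} − E_s)[ Σ_{l=h}^H γ^{l−h}·(Q̃_l − r_l^π − γ·P_l^π Ṽ_{l+1})(s_l,b_l) ], with (P_l^π Ṽ_{l+1})(s,b) = Σ_{s'} P_l^π(s'|s,b)·Ṽ_{l+1}(s'). Then for every h ∈ [H]: (i) E^{π,ν}[ |Δ̃_h⁽¹⁾(s_h,b_h)| ] ≤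 6·(η⁻¹ + 2B_A)·eff_H(γ) · max_{h'∈[H]} E^{π,ν}[ D_TV(ν_{h'}(·|s_{h'}), ν̃_{h'}(·|s_{h'})) ]; and (ii) for every (s,b) ∈ S×B, (Δ̃_h⁽¹⁾(s,b))² ≤ 2·( (Q_h^π − Q̃_h)(s,b) − Σ_{b'} ν_h(b'|s)·(Q_h^π − Q̃_h)(s,b') )² + 16·γ²·(η⁻¹ + 2B_A)²·eff_H(γ)·Σ_{l=h+1}^H γ^{l−h−1}·( E_s[ D_H²(ν_l(·|s_l), ν̃_l(·|s_l)) ] + E_{s,b}[ D_H²(ν_l(·|s_l), ν̃_l(·|s_l)) ] ). -/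
open Finset

noncomputable section

namespace QSE

variable {S A B : Type}

/-- Follower reward under the leader policy: `r_h^π(s,b) = Σ_a π_h(a|s,b) r_h(s,a,b)`. -/
def rPol [Fintype A] (pol : ℕ → S → B → A → ℝ) (r : ℕ → S → A → B → ℝ)
    (h : ℕ) (s : S) (b : B) : ℝ :=
  ∑ a, pol h s b a * r h s a b

/-- Transition under the leader policy: `P_h^π(s'|s,b) = Σ_a π_h(a|s,b) P_h(s'|s,a,b)`. -/
def pPol [Fintype A] (pol : ℕ → S → B → A → ℝ) (P : ℕ → S → A → B → S → ℝ)
    (h : ℕ) (s : S) (b : B) (s' : S) : ℝ :=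
  ∑ a, pol h s b a * P h s a b s'

/-- Fuel-indexed soft state value: `vAux n = V_{H−n}^π` (steps are 0-based, `V_H ≡ 0`). -/
def vAux [Fintype S] [Fintype A] [Fintype B] (η γ : ℝ) (H : ℕ)
    (pol : ℕ → S → B → A → ℝ) (r : ℕ → S → A → B → ℝ)
    (P : ℕ → S → A → B → S → ℝ) : ℕ → S → ℝ
  | 0, _ => 0
  | n + 1, s =>
      η⁻¹ * Real.log (∑ b, Real.exp (η * (rPol pol r (H - (n + 1)) s b +
        γ * ∑ s', pPol pol P (H - (n + 1)) s b s' * vAux η γ H pol r P n s')))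

/-- Follower soft state value `V_h^π` (0-based step `h`, so `V_H ≡ 0`). -/
def softV [Fintype S] [Fintype A] [Fintype B] (η γ : ℝ) (H : ℕ)
    (pol : ℕ → S → B → A → ℝ) (r : ℕ → S → A → B → ℝ)
    (P : ℕ → S → A → B → S → ℝ) (h : ℕ) (s : S) : ℝ :=
  vAux η γ H pol r P (H - h) s

/-- Follower soft action value `Q_h^π(s,b) = r_h^π(s,b) + γ Σ_{s'} P_h^π(s'|s,b) V_{h+1}^π(s')`. -/
def softQ [Fintype S] [Fintype A] [Fintype B] (η γ : ℝ) (H : ℕ)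
    (pol : ℕ → S → B → A → ℝ) (r : ℕ → S → A → B → ℝ)
    (P : ℕ → S → A → B → S → ℝ) (h : ℕ) (s : S) (b : B) : ℝ :=
  rPol pol r h s b + γ * ∑ s', pPol pol P h s b s' * softV η γ H pol r P (h + 1) s'

/-- Follower advantage `A_h^π = Q_h^π − V_h^π`. -/
def softA [Fintype S] [Fintype A] [Fintype B] (η γ : ℝ) (H : ℕ)
    (pol : ℕ → S → B → A → ℝ) (r : ℕ → S → A → B → ℝ)
    (P : ℕ → S → A → B → S → ℝ) (h : ℕ) (s : S) (b : B) : ℝ :=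
  softQ η γ H pol r P h s b - softV η γ H pol r P h s

/-- Quantal response `ν_h^π(b|s) = exp(η A_h^π(s,b))`. -/
def qr [Fintype S] [Fintype A] [Fintype B] (η γ : ℝ) (H : ℕ)
    (pol : ℕ → S → B → A → ℝ) (r : ℕ → S → A → B → ℝ)
    (P : ℕ → S → A → B → S → ℝ) (h : ℕ) (s : S) (b : B) : ℝ :=
  Real.exp (η * softA η γ H pol r P h s b)

/-- Marginal law of the state `s_h` along the trajectory generated by `(ρ₀, ν, π, P)`. -/
def margS [Fintype S] [Fintype A] [Fintype B] (rho0 : S → ℝ)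
    (pol : ℕ → S → B → A → ℝ) (nu : ℕ → S → B → ℝ)
    (P : ℕ → S → A → B → S → ℝ) : ℕ → S → ℝ
  | 0, s => rho0 s
  | h + 1, s' => ∑ s, ∑ b, ∑ a,
      margS rho0 pol nu P h s * nu h s b * pol h s b a * P h s a b s'

/-- Integral operator `(T_h^{π,ν} f)(s) = Σ_{a,b} π_h(a|s,b) ν_h(b|s) f(s,a,b)`. -/
def Top [Fintype A] [Fintype B] (pol : ℕ → S → B → A → ℝ) (nu : ℕ → S → B → ℝ)
    (h : ℕ) (f : S → A → B → ℝ) (s : S) : ℝ :=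
  ∑ b, ∑ a, nu h s b * pol h s b a * f s a b

/-- Leader's value `J(π) = E^{π,ν^π}[Σ_{h<H} u_h(s_h,a_h,b_h)]`. -/
def Jval [Fintype S] [Fintype A] [Fintype B] (η γ : ℝ) (H : ℕ) (rho0 : S → ℝ)
    (pol : ℕ → S → B → A → ℝ) (r : ℕ → S → A → B → ℝ)
    (P : ℕ → S → A → B → S → ℝ) (u : ℕ → S → A → B → ℝ) : ℝ :=
  ∑ h ∈ Finset.range H, ∑ s, ∑ b, ∑ a,
    margS rho0 pol (qr η γ H pol r P) P h s * qr η γ H pol r P h s b *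
      pol h s b a * u h s a b

/-- Fuel-indexed conditional discounted cumulative value:
`cumAux n s b = E[Σ_{l=H−n}^{H−1} γ^{l−(H−n)} X_l(s_l,b_l) | s_{H−n} = s, b_{H−n} = b]`. -/
def cumAux [Fintype S] [Fintype A] [Fintype B] (γ : ℝ) (H : ℕ)
    (pol : ℕ → S → B → A → ℝ) (nu : ℕ → S → B → ℝ)
    (P : ℕ → S → A → B → S → ℝ) (X : ℕ → S → B → ℝ) : ℕ → S → B → ℝ
  | 0, _, _ => 0
  | n + 1, s, b => X (H - (n + 1)) s b +
      γ * ∑ a, pol (H - (n + 1)) s b a * ∑ s', P (H - (n + 1)) s a b s' *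
          ∑ b', nu (H - n) s' b' * cumAux γ H pol nu P X n s' b'

/-- `cumSB h s b = E[Σ_{l=h}^{H−1} γ^{l−h} X_l(s_l,b_l) | s_h = s, b_h = b]`. -/
def cumSB [Fintype S] [Fintype A] [Fintype B] (γ : ℝ) (H : ℕ)
    (pol : ℕ → S → B → A → ℝ) (nu : ℕ → S → B → ℝ)
    (P : ℕ → S → A → B → S → ℝ) (X : ℕ → S → B → ℝ) (h : ℕ) (s : S) (b : B) : ℝ :=
  cumAux γ H pol nu P X (H - h) s b

/-- Estimated soft state value `Ṽ_h` derived from `Q̃` (with `Ṽ_H ≡ 0`). -/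
def vTil [Fintype B] (η : ℝ) (H : ℕ) (Qt : ℕ → S → B → ℝ) (h : ℕ) (s : S) : ℝ :=
  if h < H then η⁻¹ * Real.log (∑ b, Real.exp (η * Qt h s b)) else 0

/-- Estimated advantage `Ã_h = Q̃_h − Ṽ_h`. -/
def aTil [Fintype B] (η : ℝ) (H : ℕ) (Qt : ℕ → S → B → ℝ) (h : ℕ) (s : S) (b : B) : ℝ :=
  Qt h s b - vTil η H Qt h s

/-- Estimated quantal response `ν̃_h(b|s) = exp(η Ã_h(s,b))`. -/
def nuTil [Fintype B] (η : ℝ) (H : ℕ) (Qt : ℕ → S → B → ℝ) (h : ℕ) (s : S) (b : B) : ℝ :=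
  Real.exp (η * aTil η H Qt h s b)

/-- Follower Bellman residual `(Q̃_h − r_h^π − γ P_h^π Ṽ_{h+1})(s,b)`. -/
def bres [Fintype S] [Fintype A] [Fintype B] (η γ : ℝ) (H : ℕ)
    (pol : ℕ → S → B → A → ℝ) (r : ℕ → S → A → B → ℝ)
    (P : ℕ → S → A → B → S → ℝ) (Qt : ℕ → S → B → ℝ) (h : ℕ) (s : S) (b : B) : ℝ :=
  Qt h s b - rPol pol r h s b - γ * ∑ s', pPol pol P h s b s' * vTil η H Qt (h + 1) s'

/-- First-order quantal response error
`Δ̃_h⁽¹⁾(s,b) = (E_{s,b} − E_s)[Σ_{l=h}^{H−1} γ^{l−h}(Q̃_l − r_l^π − γ P_l^π Ṽ_{l+1})(s_l,b_l)]`. -/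
def del1 [Fintype S] [Fintype A] [Fintype B] (η γ : ℝ) (H : ℕ)
    (pol : ℕ → S → B → A → ℝ) (r : ℕ → S → A → B → ℝ)
    (P : ℕ → S → A → B → S → ℝ) (Qt : ℕ → S → B → ℝ) (h : ℕ) (s : S) (b : B) : ℝ :=
  cumSB γ H pol (qr η γ H pol r P) P (bres η γ H pol r P Qt) h s b -
    ∑ b', qr η γ H pol r P h s b' *
      cumSB γ H pol (qr η γ H pol r P) P (bres η γ H pol r P Qt) h s b'

/-- Geometric sum `eff_H(x) = Σ_{i<H} x^i`. -/
def effH (H : ℕ) (x : ℝ) : ℝ := ∑ i ∈ Finset.range H, x ^ i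

end QSE

namespace QSE

/-- `k`-step state transition kernel started at step `h` under `(π, ν)`:
`transK h k s s' = P(s_{h+k} = s' | s_h = s)`. -/
def transK [Fintype S] [Fintype A] [Fintype B] [DecidableEq S]
    (pol : ℕ → S → B → A → ℝ) (nu : ℕ → S → B → ℝ)
    (P : ℕ → S → A → B → S → ℝ) (h : ℕ) : ℕ → S → S → ℝ
  | 0, s, s' => if s' = s then 1 else 0
  | k + 1, s, s'' => ∑ s', transK pol nu P h k s s' *
      ∑ b, ∑ a, nu (h + k) s' b * pol (h + k) s' b a * P (h + k) s' a b s''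

end QSE

open QSE

namespace QSE

theorem hp_pointwise (η BA a t : ℝ) (hη : 0 < η) (ha : |a| ≤ BA) (ht : |t| ≤ BA) :
    Real.exp (η * a) * |t - a| ≤
      (η⁻¹ + 2 * BA) * |Real.exp (η * a) - Real.exp (η * t)| := by
  have hBA : 0 ≤ BA := (abs_nonneg a).trans ha
  have hi : 0 < η⁻¹ := inv_pos.mpr hη
  obtain ⟨ha1, ha2⟩ := abs_le.mp ha
  obtain ⟨ht1, ht2⟩ := abs_le.mp ht
  have key : ∀ x y : ℝ, Real.exp (η * x) * (y - x) ≤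
      η⁻¹ * (Real.exp (η * y) - Real.exp (η * x)) := by
    intro x y
    have h1 := Real.add_one_le_exp (η * (y - x))
    have h2 : Real.exp (η * y) = Real.exp (η * x) * Real.exp (η * (y - x)) := by
      rw [← Real.exp_add]; ring_nf
    have h3 : η⁻¹ * (η * (y - x)) ≤ η⁻¹ * (Real.exp (η * (y - x)) - 1) :=
      mul_le_mul_of_nonneg_left (by linarith) hi.le
    rw [inv_mul_cancel_left₀ hη.ne'] at h3
    have h4 := mul_le_mul_of_nonneg_left h3 (Real.exp_pos (η * x)).le
    rw [h2]
    linarith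
  rcases le_total a t with h | h
  · have hm : Real.exp (η * a) ≤ Real.exp (η * t) :=
      Real.exp_le_exp.mpr (mul_le_mul_of_nonneg_left h hη.le)
    rw [abs_of_nonneg (by linarith : 0 ≤ t - a), abs_of_nonpos (by linarith)]
    have := key a t
    nlinarith
  · have hm : Real.exp (η * t) ≤ Real.exp (η * a) :=
      Real.exp_le_exp.mpr (mul_le_mul_of_nonneg_left h hη.le)
    rw [abs_of_nonpos (by linarith : t - a ≤ 0), abs_of_nonneg (by linarith)]
    have := key t a
    have h5 : (Real.exp (η * a) - Real.exp (η * t)) * (a - t) ≤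
        (Real.exp (η * a) - Real.exp (η * t)) * (2 * BA) :=
      mul_le_mul_of_nonneg_left (by linarith) (by linarith)
    nlinarith

theorem hp_lse {B : Type} [Fintype B] [Nonempty B] (η : ℝ) (hη : 0 < η) (q : B → ℝ) :
    ∑ b, Real.exp (η * (q b - η⁻¹ * Real.log (∑ b, Real.exp (η * q b)))) = 1 := by
  have hpos : 0 < ∑ b, Real.exp (η * q b) :=
    Finset.sum_pos (fun b _ => Real.exp_pos _) Finset.univ_nonempty
  have : ∀ b, Real.exp (η * (q b - η⁻¹ * Real.log (∑ b, Real.exp (η * q b)))) =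
      Real.exp (η * q b) / ∑ b, Real.exp (η * q b) := by
    intro b
    rw [mul_sub, mul_inv_cancel_left₀ hη.ne', Real.exp_sub, Real.exp_log hpos]
  simp_rw [this]
  rw [← Finset.sum_div, div_self hpos.ne']

theorem hp_kl {B : Type} [Fintype B] (η : ℝ) (hη : 0 < η) (a t : B → ℝ)
    (h1 : ∑ b, Real.exp (η * a b) = 1) (h2 : ∑ b, Real.exp (η * t b) = 1) :
    ∑ b, Real.exp (η * a b) * (t b - a b) ≤ 0 := by
  have key : ∀ b, η * (Real.exp (η * a b) * (t b - a b)) ≤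
      Real.exp (η * t b) - Real.exp (η * a b) := by
    intro b
    have h1 := Real.add_one_le_exp (η * (t b - a b))
    have h2 : Real.exp (η * t b) = Real.exp (η * a b) * Real.exp (η * (t b - a b)) := by
      rw [← Real.exp_add]; ring_nf
    have h4 := mul_le_mul_of_nonneg_left h1 (Real.exp_pos (η * a b)).le
    rw [h2]
    linarith
  have := Finset.sum_le_sum (fun b (_ : b ∈ Finset.univ) => key b)
  rw [← Finset.mul_sum, Finset.sum_sub_distrib, h1, h2] at this
  by_contra hc
  push Not at hc
  nlinarith [mul_pos hη hc]

theorem hp_hell {B : Type} [Fintype B] (p q : B → ℝ) (hp : ∀ b, 0 ≤ p b) (hq : ∀ b, 0 ≤ q b)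
    (h1 : ∑ b, p b = 1) (h2 : ∑ b, q b = 1) :
    (∑ b, |p b - q b|) ^ 2 ≤
      8 * ((1 / 2) * ∑ b, (Real.sqrt (p b) - Real.sqrt (q b)) ^ 2) := by
  have e : ∀ b, |p b - q b| =
      |Real.sqrt (p b) - Real.sqrt (q b)| * (Real.sqrt (p b) + Real.sqrt (q b)) := by
    intro b
    have : p b - q b = (Real.sqrt (p b) - Real.sqrt (q b)) * (Real.sqrt (p b) + Real.sqrt (q b)) := by
      nlinarith [Real.sq_sqrt (hp b), Real.sq_sqrt (hq b)]
    rw [this, abs_mul, abs_of_nonneg (a := Real.sqrt (p b) + Real.sqrt (q b)) (by positivity)]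
  have cs := Finset.sum_mul_sq_le_sq_mul_sq Finset.univ
    (fun b => |Real.sqrt (p b) - Real.sqrt (q b)|) (fun b => Real.sqrt (p b) + Real.sqrt (q b))
  simp_rw [e]
  have h4 : ∑ b, (Real.sqrt (p b) + Real.sqrt (q b)) ^ 2 ≤ 4 := by
    have : ∀ b ∈ (Finset.univ : Finset B), (Real.sqrt (p b) + Real.sqrt (q b)) ^ 2 ≤ 2 * p b + 2 * q b := by
      intro b _
      nlinarith [Real.sq_sqrt (hp b), Real.sq_sqrt (hq b),
        sq_nonneg (Real.sqrt (p b) - Real.sqrt (q b))]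
    have := Finset.sum_le_sum this
    rw [Finset.sum_add_distrib, ← Finset.mul_sum, ← Finset.mul_sum, h1, h2] at this
    linarith
  simp only [sq_abs] at cs
  have h0 : 0 ≤ ∑ b, (Real.sqrt (p b) - Real.sqrt (q b)) ^ 2 :=
    Finset.sum_nonneg (fun b _ => sq_nonneg _)
  nlinarith

/-- Jensen for finite probability weights. -/
theorem hp_jensen {S : Type} [Fintype S] (w x : S → ℝ) (hw : ∀ s, 0 ≤ w s) (h1 : ∑ s, w s = 1) :
    (∑ s, w s * x s) ^ 2 ≤ ∑ s, w s * x s ^ 2 := by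
  have h2 : 0 ≤ ∑ s, w s * (x s - ∑ s, w s * x s) ^ 2 :=
    Finset.sum_nonneg (fun s _ => mul_nonneg (hw s) (sq_nonneg _))
  set m := ∑ s, w s * x s with hm
  have h3 : ∑ s, w s * (x s - m) ^ 2 = ∑ s, w s * x s ^ 2 - 2 * m * ∑ s, w s * x s + m ^ 2 * ∑ s, w s := by
    rw [Finset.mul_sum Finset.univ _ (2 * m), Finset.mul_sum Finset.univ _ (m ^ 2),
      ← Finset.sum_sub_distrib, ← Finset.sum_add_distrib]
    exact Finset.sum_congr rfl (fun s _ => by ring)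
  rw [h3, h1, ← hm] at h2
  nlinarith

/-- Weighted Cauchy-Schwarz. -/
theorem hp_cs (t : Finset ℕ) (w x : ℕ → ℝ) (hw : ∀ s, 0 ≤ w s) :
    (∑ s ∈ t, w s * x s) ^ 2 ≤ (∑ s ∈ t, w s) * ∑ s ∈ t, w s * x s ^ 2 := by
  have := Finset.sum_mul_sq_le_sq_mul_sq t (fun s => Real.sqrt (w s)) (fun s => Real.sqrt (w s) * x s)
  simp only [mul_pow, Real.sq_sqrt (hw _), ← mul_assoc, Real.mul_self_sqrt (hw _)] at this
  exact this

section core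
variable {S A B : Type} [Fintype S] [Fintype A] [Fintype B]

theorem hp_softV [Nonempty B] (η γ : ℝ) (H : ℕ) (pol : ℕ → S → B → A → ℝ)
    (r : ℕ → S → A → B → ℝ) (P : ℕ → S → A → B → S → ℝ) (h : ℕ) (hh : h < H) (s : S) :
    softV η γ H pol r P h s =
      η⁻¹ * Real.log (∑ b, Real.exp (η * softQ η γ H pol r P h s b)) := by
  obtain ⟨n, rfl⟩ : ∃ n, H = h + (n + 1) := ⟨H - h - 1, by omega⟩
  have e1 : h + (n + 1) - h = n + 1 := by omega
  have e2 : h + (n + 1) - (n + 1) = h := by omega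
  have e3 : h + (n + 1) - (h + 1) = n := by omega
  simp only [softQ, softV, e1, e3, vAux, e2]

theorem hp_qr_sum [Nonempty B] (η γ : ℝ) (hη : 0 < η) (H : ℕ) (pol : ℕ → S → B → A → ℝ)
    (r : ℕ → S → A → B → ℝ) (P : ℕ → S → A → B → S → ℝ) (h : ℕ) (hh : h < H) (s : S) :
    ∑ b, qr η γ H pol r P h s b = 1 := by
  simp only [qr, softA, hp_softV η γ H pol r P h hh]
  exact hp_lse η hη _

theorem hp_nuTil_sum [Nonempty B] (η : ℝ) (hη : 0 < η) (H : ℕ) (Qt : ℕ → S → B → ℝ)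
    (h : ℕ) (hh : h < H) (s : S) :
    ∑ b, nuTil η H Qt h s b = 1 := by
  simp only [nuTil, aTil, vTil, if_pos hh]
  exact hp_lse η hη _

theorem hp_pPol_sum (pol : ℕ → S → B → A → ℝ) (P : ℕ → S → A → B → S → ℝ) (h : ℕ) (s : S) (b : B)
    (F : S → ℝ) :
    ∑ s', pPol pol P h s b s' * F s' = ∑ a, pol h s b a * ∑ s', P h s a b s' * F s' := by
  simp only [pPol, Finset.sum_mul, Finset.mul_sum]
  rw [Finset.sum_comm]
  simp only [mul_assoc]

theorem hp_cumSB (γ : ℝ) (H : ℕ) (pol : ℕ → S → B → A → ℝ) (nu : ℕ → S → B → ℝ)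
    (P : ℕ → S → A → B → S → ℝ) (X : ℕ → S → B → ℝ) (h : ℕ) (hh : h < H) (s : S) (b : B) :
    cumSB γ H pol nu P X h s b = X h s b + γ * ∑ s', pPol pol P h s b s' *
      ∑ b', nu (h + 1) s' b' * cumSB γ H pol nu P X (h + 1) s' b' := by
  obtain ⟨n, rfl⟩ : ∃ n, H = h + (n + 1) := ⟨H - h - 1, by omega⟩
  have e1 : h + (n + 1) - h = n + 1 := by omega
  have e2 : h + (n + 1) - (n + 1) = h := by omega
  have e3 : h + (n + 1) - (h + 1) = n := by omega
  have e4 : h + (n + 1) - n = h + 1 := by omega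
  rw [hp_pPol_sum]
  simp only [cumSB, e1, e3, cumAux, e2, e4]

/-- One-step error. -/
def epsF (η γ : ℝ) (H : ℕ) (pol : ℕ → S → B → A → ℝ)
    (r : ℕ → S → A → B → ℝ) (P : ℕ → S → A → B → S → ℝ) (Qt : ℕ → S → B → ℝ)
    (h : ℕ) (s : S) : ℝ :=
  ∑ b, qr η γ H pol r P h s b * (aTil η H Qt h s b - softA η γ H pol r P h s b)

/-- Accumulated error. -/
def uF (η γ : ℝ) (H : ℕ) (pol : ℕ → S → B → A → ℝ)
    (r : ℕ → S → A → B → ℝ) (P : ℕ → S → A → B → S → ℝ) (Qt : ℕ → S → B → ℝ)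
    (h : ℕ) (s : S) : ℝ :=
  softV η γ H pol r P h s - vTil η H Qt h s + ∑ b, qr η γ H pol r P h s b *
    cumSB γ H pol (qr η γ H pol r P) P (bres η γ H pol r P Qt) h s b

theorem hp_uF_H (η γ : ℝ) (H : ℕ) (pol : ℕ → S → B → A → ℝ)
    (r : ℕ → S → A → B → ℝ) (P : ℕ → S → A → B → S → ℝ) (Qt : ℕ → S → B → ℝ) (s : S) :
    uF η γ H pol r P Qt H s = 0 := by
  simp [uF, softV, vTil, cumSB, vAux, cumAux]

theorem hp_W (η γ : ℝ) (H : ℕ) (pol : ℕ → S → B → A → ℝ)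
    (r : ℕ → S → A → B → ℝ) (P : ℕ → S → A → B → S → ℝ) (Qt : ℕ → S → B → ℝ)
    (h : ℕ) (hh : h < H) (s : S) (b : B) :
    cumSB γ H pol (qr η γ H pol r P) P (bres η γ H pol r P Qt) h s b =
      (Qt h s b - softQ η γ H pol r P h s b) +
        γ * ∑ s', pPol pol P h s b s' * uF η γ H pol r P Qt (h + 1) s' := by
  rw [hp_cumSB _ _ _ _ _ _ _ hh]
  simp only [uF, bres, softQ, mul_add, mul_sub, Finset.sum_add_distrib, Finset.sum_sub_distrib]
  ring

theorem hp_uF [Nonempty B] (η γ : ℝ) (hη : 0 < η) (H : ℕ) (pol : ℕ → S → B → A → ℝ)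
    (r : ℕ → S → A → B → ℝ) (P : ℕ → S → A → B → S → ℝ) (Qt : ℕ → S → B → ℝ)
    (h : ℕ) (hh : h < H) (s : S) :
    uF η γ H pol r P Qt h s = epsF η γ H pol r P Qt h s +
      γ * ∑ b, qr η γ H pol r P h s b *
        ∑ s', pPol pol P h s b s' * uF η γ H pol r P Qt (h + 1) s' := by
  have hs := hp_qr_sum η γ hη H pol r P h hh s
  have h1 : softV η γ H pol r P h s - vTil η H Qt h s =
      ∑ b, qr η γ H pol r P h s b * (softV η γ H pol r P h s - vTil η H Qt h s) := by
    rw [← Finset.sum_mul, hs, one_mul]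
  rw [uF, h1, epsF, Finset.mul_sum, ← Finset.sum_add_distrib, ← Finset.sum_add_distrib]
  refine Finset.sum_congr rfl (fun b _ => ?_)
  rw [hp_W _ _ _ _ _ _ _ _ hh, aTil, softA]
  ring

theorem hp_del1 [Nonempty B] (η γ : ℝ) (hη : 0 < η) (H : ℕ) (pol : ℕ → S → B → A → ℝ)
    (r : ℕ → S → A → B → ℝ) (P : ℕ → S → A → B → S → ℝ) (Qt : ℕ → S → B → ℝ)
    (h : ℕ) (hh : h < H) (s : S) (b : B) :
    del1 η γ H pol r P Qt h s b =
      ((Qt h s b - softQ η γ H pol r P h s b) -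
        ∑ b', qr η γ H pol r P h s b' * (Qt h s b' - softQ η γ H pol r P h s b')) +
      γ * (∑ s', pPol pol P h s b s' * uF η γ H pol r P Qt (h + 1) s' -
        ∑ b', qr η γ H pol r P h s b' *
          ∑ s', pPol pol P h s b' s' * uF η γ H pol r P Qt (h + 1) s') := by
  simp only [del1, hp_W _ _ _ _ _ _ _ _ hh]
  have : ∀ b' : B, qr η γ H pol r P h s b' * (Qt h s b' - softQ η γ H pol r P h s b' +
        γ * ∑ s', pPol pol P h s b' s' * uF η γ H pol r P Qt (h + 1) s') =
      qr η γ H pol r P h s b' * (Qt h s b' - softQ η γ H pol r P h s b') +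
      γ * (qr η γ H pol r P h s b' *
          ∑ s', pPol pol P h s b' s' * uF η γ H pol r P Qt (h + 1) s') := by
    intro b'; ring
  simp only [this, Finset.sum_add_distrib, ← Finset.mul_sum]
  ring

theorem hp_margS_succ (rho0 : S → ℝ) (pol : ℕ → S → B → A → ℝ) (nu : ℕ → S → B → ℝ)
    (P : ℕ → S → A → B → S → ℝ) (h : ℕ) (F : S → ℝ) :
    ∑ s', margS rho0 pol nu P (h + 1) s' * F s' =
      ∑ s, margS rho0 pol nu P h s * ∑ b, nu h s b * ∑ s', pPol pol P h s b s' * F s' := by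
  simp only [hp_pPol_sum, margS, Finset.sum_mul, Finset.mul_sum]
  rw [Finset.sum_comm]
  refine Finset.sum_congr rfl (fun s _ => ?_)
  rw [Finset.sum_comm]
  refine Finset.sum_congr rfl (fun b _ => ?_)
  rw [Finset.sum_comm]
  refine Finset.sum_congr rfl (fun a _ => ?_)
  exact Finset.sum_congr rfl (fun s' _ => by ring)

theorem hp_trans_succ [DecidableEq S] (pol : ℕ → S → B → A → ℝ) (nu : ℕ → S → B → ℝ)
    (P : ℕ → S → A → B → S → ℝ) (h k : ℕ) (s : S) (F : S → ℝ) :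
    ∑ s'', transK pol nu P h (k + 1) s s'' * F s'' =
      ∑ s', transK pol nu P h k s s' *
        ∑ b, nu (h + k) s' b * ∑ s'', pPol pol P (h + k) s' b s'' * F s'' := by
  simp only [hp_pPol_sum, transK, Finset.sum_mul, Finset.mul_sum]
  rw [Finset.sum_comm]
  refine Finset.sum_congr rfl (fun s _ => ?_)
  rw [Finset.sum_comm]
  refine Finset.sum_congr rfl (fun b _ => ?_)
  rw [Finset.sum_comm]
  refine Finset.sum_congr rfl (fun a _ => ?_)
  exact Finset.sum_congr rfl (fun s' _ => by ring)

theorem hp_trans_zero [DecidableEq S] (pol : ℕ → S → B → A → ℝ) (nu : ℕ → S → B → ℝ)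
    (P : ℕ → S → A → B → S → ℝ) (h : ℕ) (s : S) (F : S → ℝ) :
    ∑ s', transK pol nu P h 0 s s' * F s' = F s := by
  simp [transK]

theorem hp_trans_first [DecidableEq S] (pol : ℕ → S → B → A → ℝ) (nu : ℕ → S → B → ℝ)
    (P : ℕ → S → A → B → S → ℝ) (h k : ℕ) (s : S) (F : S → ℝ) :
    ∑ s'', transK pol nu P h (k + 1) s s'' * F s'' =
      ∑ b, nu h s b * ∑ s1, pPol pol P h s b s1 *
        ∑ s'', transK pol nu P (h + 1) k s1 s'' * F s'' := by
  induction k generalizing F with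
  | zero =>
    rw [hp_trans_succ]
    simp only [hp_trans_zero, Nat.add_zero]
  | succ k ih =>
    rw [hp_trans_succ, ih]
    simp only [hp_trans_succ pol nu P (h + 1) k, show h + (k + 1) = h + 1 + k by omega]

theorem hp_lin {T : Type} [Fintype T] (t : Finset ℕ) (p : T → ℝ) (w : ℕ → ℝ) (Z : ℕ → T → ℝ) :
    ∑ s, p s * ∑ l ∈ t, w l * Z l s = ∑ l ∈ t, w l * ∑ s, p s * Z l s := by
  simp only [Finset.mul_sum]
  rw [Finset.sum_comm]
  exact Finset.sum_congr rfl (fun l _ => Finset.sum_congr rfl (fun s _ => by ring))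

theorem hp_uexp [Nonempty B] [DecidableEq S] (η γ : ℝ) (hη : 0 < η) (H : ℕ)
    (pol : ℕ → S → B → A → ℝ)
    (r : ℕ → S → A → B → ℝ) (P : ℕ → S → A → B → S → ℝ) (Qt : ℕ → S → B → ℝ)
    (n : ℕ) : ∀ h, h + n = H → ∀ s, uF η γ H pol r P Qt h s =
      ∑ l ∈ Finset.Ico h H, γ ^ (l - h) *
        ∑ s', transK pol (qr η γ H pol r P) P h (l - h) s s' * epsF η γ H pol r P Qt l s' := by
  induction n with
  | zero =>
    intro h hh s
    have : h = H := by omega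
    subst this
    simp [hp_uF_H]
  | succ n ih =>
    intro h hh s
    have hlt : h < H := by omega
    rw [hp_uF η γ hη H pol r P Qt h hlt, Finset.sum_eq_sum_Ico_succ_bot hlt]
    simp only [ih (h + 1) (by omega), hp_lin]
    rw [Nat.sub_self, hp_trans_zero, pow_zero, one_mul, Finset.mul_sum]
    congr 1
    refine Finset.sum_congr rfl (fun l hl => ?_)
    rw [Finset.mem_Ico] at hl
    have e : l - h = (l - (h + 1)) + 1 := by omega
    rw [e, hp_trans_first, pow_succ]
    ring

/-- Basic probability facts for the induced kernel. -/
theorem hp_pPol_nonneg (H : ℕ) (P : ℕ → S → A → B → S → ℝ)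
    (hP0 : ∀ h < H, ∀ s a b s', 0 ≤ P h s a b s')
    (pol : ℕ → S → B → A → ℝ) (hpol0 : ∀ h < H, ∀ s b a, 0 ≤ pol h s b a)
    (h : ℕ) (hh : h < H) (s : S) (b : B) (s' : S) : 0 ≤ pPol pol P h s b s' :=
  Finset.sum_nonneg (fun a _ => mul_nonneg (hpol0 h hh s b a) (hP0 h hh s a b s'))

theorem hp_pPol_one (H : ℕ) (P : ℕ → S → A → B → S → ℝ)
    (hP1 : ∀ h < H, ∀ s a b, ∑ s', P h s a b s' = 1)
    (pol : ℕ → S → B → A → ℝ) (hpol1 : ∀ h < H, ∀ s b, ∑ a, pol h s b a = 1)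
    (h : ℕ) (hh : h < H) (s : S) (b : B) : ∑ s', pPol pol P h s b s' = 1 := by
  have := hp_pPol_sum pol P h s b (fun _ => 1)
  simp only [mul_one, hP1 h hh, hpol1 h hh] at this
  exact this

theorem hp_trans_nonneg [DecidableEq S] (H : ℕ) (P : ℕ → S → A → B → S → ℝ)
    (hP0 : ∀ h < H, ∀ s a b s', 0 ≤ P h s a b s')
    (pol : ℕ → S → B → A → ℝ) (hpol0 : ∀ h < H, ∀ s b a, 0 ≤ pol h s b a)
    (nu : ℕ → S → B → ℝ) (hnu : ∀ h s b, 0 ≤ nu h s b)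
    (h k : ℕ) (hh : h + k ≤ H) (s s' : S) : 0 ≤ transK pol nu P h k s s' := by
  induction k generalizing s' with
  | zero => simp only [transK]; split_ifs <;> norm_num
  | succ k ih =>
    refine Finset.sum_nonneg (fun s1 _ => mul_nonneg (ih (by omega) s1) ?_)
    refine Finset.sum_nonneg (fun b _ => Finset.sum_nonneg (fun a _ => ?_))
    exact mul_nonneg (mul_nonneg (hnu _ _ _) (hpol0 _ (by omega) _ _ _)) (hP0 _ (by omega) _ _ _ _)

theorem hp_trans_one [DecidableEq S] (H : ℕ) (P : ℕ → S → A → B → S → ℝ)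
    (hP1 : ∀ h < H, ∀ s a b, ∑ s', P h s a b s' = 1)
    (pol : ℕ → S → B → A → ℝ) (hpol1 : ∀ h < H, ∀ s b, ∑ a, pol h s b a = 1)
    (nu : ℕ → S → B → ℝ) (hnu : ∀ h < H, ∀ s, ∑ b, nu h s b = 1)
    (h k : ℕ) (hh : h + k ≤ H) (s : S) : ∑ s', transK pol nu P h k s s' = 1 := by
  induction k with
  | zero => simp [transK]
  | succ k ih =>
    have := hp_trans_succ pol nu P h k s (fun _ => 1)
    simp only [mul_one, hp_pPol_one H P hP1 pol hpol1 (h + k) (by omega), hnu (h + k) (by omega),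
      ih (by omega)] at this
    exact this

theorem hp_marg_nonneg (H : ℕ) (rho0 : S → ℝ) (hrho0 : ∀ s, 0 ≤ rho0 s)
    (P : ℕ → S → A → B → S → ℝ)
    (hP0 : ∀ h < H, ∀ s a b s', 0 ≤ P h s a b s')
    (pol : ℕ → S → B → A → ℝ) (hpol0 : ∀ h < H, ∀ s b a, 0 ≤ pol h s b a)
    (nu : ℕ → S → B → ℝ) (hnu : ∀ h s b, 0 ≤ nu h s b)
    (h : ℕ) (hh : h ≤ H) (s : S) : 0 ≤ margS rho0 pol nu P h s := by
  induction h generalizing s with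
  | zero => exact hrho0 s
  | succ k ih =>
    refine Finset.sum_nonneg (fun s1 _ => Finset.sum_nonneg (fun b _ => Finset.sum_nonneg
      (fun a _ => ?_)))
    exact mul_nonneg (mul_nonneg (mul_nonneg (ih (by omega) s1) (hnu _ _ _))
      (hpol0 _ (by omega) _ _ _)) (hP0 _ (by omega) _ _ _ _)

theorem hp_qr_nonneg (η γ : ℝ) (H : ℕ) (pol : ℕ → S → B → A → ℝ)
    (r : ℕ → S → A → B → ℝ) (P : ℕ → S → A → B → S → ℝ) (h : ℕ) (s : S) (b : B) :
    0 ≤ qr η γ H pol r P h s b := (Real.exp_pos _).le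

theorem hp_abs_sum {T : Type} [Fintype T] (p x : T → ℝ) (hp : ∀ s, 0 ≤ p s) :
    |∑ s, p s * x s| ≤ ∑ s, p s * |x s| := by
  refine (Finset.abs_sum_le_sum_abs _ _).trans (le_of_eq ?_)
  exact Finset.sum_congr rfl (fun s _ => by rw [abs_mul, abs_of_nonneg (hp s)])

/-- Part (i), abstract form. -/
theorem hp_part1 [Nonempty B] (H : ℕ) (η γ : ℝ) (hη : 0 < η) (hγ0 : 0 ≤ γ)
    (rho0 : S → ℝ) (hrho0 : ∀ s, 0 ≤ rho0 s)
    (P : ℕ → S → A → B → S → ℝ)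
    (hP0 : ∀ h < H, ∀ s a b s', 0 ≤ P h s a b s')
    (r : ℕ → S → A → B → ℝ)
    (pol : ℕ → S → B → A → ℝ)
    (hpol0 : ∀ h < H, ∀ s b a, 0 ≤ pol h s b a)
    (Qt : ℕ → S → B → ℝ) (D : ℝ)
    (hD : ∀ h < H, ∑ s, margS rho0 pol (qr η γ H pol r P) P h s *
      ∑ b, qr η γ H pol r P h s b *
        |aTil η H Qt h s b - softA η γ H pol r P h s b| ≤ D)
    (h : ℕ) (hh : h < H) :
    ∑ s, margS rho0 pol (qr η γ H pol r P) P h s *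
          ∑ b, qr η γ H pol r P h s b * |del1 η γ H pol r P Qt h s b| ≤
      2 * D * ∑ i ∈ Finset.range (H - h), γ ^ i := by
  set nu := qr η γ H pol r P with hnu
  have nu0 : ∀ h s b, 0 ≤ nu h s b := fun h s b => hp_qr_nonneg η γ H pol r P h s b
  have nu1 : ∀ h < H, ∀ s, ∑ b, nu h s b = 1 := fun h hh s => hp_qr_sum η γ hη H pol r P h hh s
  have m0 : ∀ h ≤ H, ∀ s, 0 ≤ margS rho0 pol nu P h s :=
    fun h hh s => hp_marg_nonneg H rho0 hrho0 P hP0 pol hpol0 nu nu0 h hh s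
  have p0 := hp_pPol_nonneg H P hP0 pol hpol0
  set u := uF η γ H pol r P Qt with hu
  -- abs of the propagated error
  have hprop : ∀ h < H, ∀ s b, |∑ s', pPol pol P h s b s' * u (h + 1) s'| ≤
      ∑ s', pPol pol P h s b s' * |u (h + 1) s'| :=
    fun h hh s b => hp_abs_sum _ _ (p0 h hh s b)
  have hU : ∀ n h, h + n = H → ∑ s, margS rho0 pol nu P h s * |u h s| ≤
      D * ∑ i ∈ Finset.range n, γ ^ i := by
    intro n
    induction n with
    | zero =>
      intro h hh
      have : h = H := by omega
      subst this
      simp [hu, hp_uF_H]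
    | succ n ih =>
      intro h hh
      have hlt : h < H := by omega
      have step : ∀ s, |u h s| ≤ (∑ b, nu h s b *
          |aTil η H Qt h s b - softA η γ H pol r P h s b|) +
          γ * ∑ b, nu h s b * ∑ s', pPol pol P h s b s' * |u (h + 1) s'| := by
        intro s
        rw [hu, hp_uF η γ hη H pol r P Qt h hlt, ← hu]
        refine (abs_add_le _ _).trans (add_le_add ?_ ?_)
        · exact hp_abs_sum _ _ (nu0 h s)
        · rw [abs_mul, abs_of_nonneg hγ0]
          refine mul_le_mul_of_nonneg_left ?_ hγ0
          refine (hp_abs_sum _ _ (nu0 h s)).trans (Finset.sum_le_sum (fun b _ => ?_))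
          exact mul_le_mul_of_nonneg_left (hprop h hlt s b) (nu0 h s b)
      have h1 := Finset.sum_le_sum (fun s (_ : s ∈ Finset.univ) =>
        mul_le_mul_of_nonneg_left (step s) (m0 h hlt.le s))
      simp only [mul_add, Finset.sum_add_distrib] at h1
      have h2 : ∑ s, margS rho0 pol nu P h s * (γ * ∑ b, nu h s b *
          ∑ s', pPol pol P h s b s' * |u (h + 1) s'|) =
          γ * ∑ s', margS rho0 pol nu P (h + 1) s' * |u (h + 1) s'| := by
        rw [hp_margS_succ, Finset.mul_sum]
        exact Finset.sum_congr rfl (fun s _ => by ring)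
      rw [h2] at h1
      have h3 := mul_le_mul_of_nonneg_left (ih (h + 1) (by omega)) hγ0
      have h4 := hD h hlt
      rw [Finset.sum_range_succ']
      simp only [pow_succ, ← Finset.sum_mul, pow_zero]
      linarith
  -- pointwise bound of the centred quantities
  have cen : ∀ (s : S) (x : B → ℝ), ∑ b, nu h s b * |x b - ∑ b', nu h s b' * x b'| ≤
      2 * ∑ b, nu h s b * |x b| := by
    intro s x
    have hx := hp_abs_sum (nu h s) x (nu0 h s)
    have : ∀ b ∈ (Finset.univ : Finset B), nu h s b * |x b - ∑ b', nu h s b' * x b'| ≤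
        nu h s b * |x b| + nu h s b * ∑ b', nu h s b' * |x b'| := by
      intro b _
      rw [← mul_add]
      refine mul_le_mul_of_nonneg_left ((abs_sub _ _).trans ?_) (nu0 h s b)
      linarith
    have := Finset.sum_le_sum this
    rw [Finset.sum_add_distrib, ← Finset.sum_mul, nu1 h hh, one_mul] at this
    linarith
  have pt : ∀ s, ∑ b, nu h s b * |del1 η γ H pol r P Qt h s b| ≤
      2 * (∑ b, nu h s b * |aTil η H Qt h s b - softA η γ H pol r P h s b|) +
      2 * γ * ∑ b, nu h s b * ∑ s', pPol pol P h s b s' * |u (h + 1) s'| := by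
    intro s
    have c1 := cen s (fun b => aTil η H Qt h s b - softA η γ H pol r P h s b)
    have c2 := cen s (fun b => ∑ s', pPol pol P h s b s' * u (h + 1) s')
    have c3 : ∑ b, nu h s b * |∑ s', pPol pol P h s b s' * u (h + 1) s'| ≤
        ∑ b, nu h s b * ∑ s', pPol pol P h s b s' * |u (h + 1) s'| :=
      Finset.sum_le_sum (fun b _ => mul_le_mul_of_nonneg_left (hprop h hh s b) (nu0 h s b))
    have e1 : ∀ b, (Qt h s b - softQ η γ H pol r P h s b) -
        ∑ b', nu h s b' * (Qt h s b' - softQ η γ H pol r P h s b') =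
        (aTil η H Qt h s b - softA η γ H pol r P h s b) -
        ∑ b', nu h s b' * (aTil η H Qt h s b' - softA η γ H pol r P h s b') := by
      intro b
      have : ∀ b', nu h s b' * (aTil η H Qt h s b' - softA η γ H pol r P h s b') =
          nu h s b' * (Qt h s b' - softQ η γ H pol r P h s b') +
          nu h s b' * (softV η γ H pol r P h s - vTil η H Qt h s) := by
        intro b'; rw [aTil, softA]; ring
      simp only [this, Finset.sum_add_distrib, ← Finset.sum_mul, nu1 h hh]
      rw [aTil, softA]; ring
    have d : ∀ b ∈ (Finset.univ : Finset B), nu h s b * |del1 η γ H pol r P Qt h s b| ≤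
        nu h s b * |(aTil η H Qt h s b - softA η γ H pol r P h s b) -
        ∑ b', nu h s b' * (aTil η H Qt h s b' - softA η γ H pol r P h s b')| +
        γ * (nu h s b * |∑ s', pPol pol P h s b s' * u (h + 1) s' -
          ∑ b', nu h s b' * ∑ s', pPol pol P h s b' s' * u (h + 1) s'|) := by
      intro b _
      rw [hp_del1 η γ hη H pol r P Qt h hh s b, ← hnu, ← hu, e1 b]
      have := abs_add_le ((aTil η H Qt h s b - softA η γ H pol r P h s b) -
        ∑ b', nu h s b' * (aTil η H Qt h s b' - softA η γ H pol r P h s b'))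
        (γ * (∑ s', pPol pol P h s b s' * u (h + 1) s' -
          ∑ b', nu h s b' * ∑ s', pPol pol P h s b' s' * u (h + 1) s'))
      have := mul_le_mul_of_nonneg_left this (nu0 h s b)
      rw [abs_mul γ, abs_of_nonneg hγ0] at this
      linarith
    have := Finset.sum_le_sum d
    rw [Finset.sum_add_distrib, ← Finset.mul_sum] at this
    have c4 := mul_le_mul_of_nonneg_left (c2.trans (mul_le_mul_of_nonneg_left c3 (by norm_num : (0:ℝ) ≤ 2))) hγ0
    linarith
  have h1 := Finset.sum_le_sum (fun s (_ : s ∈ Finset.univ) =>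
    mul_le_mul_of_nonneg_left (pt s) (m0 h hh.le s))
  simp only [mul_add, Finset.sum_add_distrib] at h1
  have h2 : ∑ s, margS rho0 pol nu P h s * (2 * γ * ∑ b, nu h s b *
      ∑ s', pPol pol P h s b s' * |u (h + 1) s'|) =
      2 * γ * ∑ s', margS rho0 pol nu P (h + 1) s' * |u (h + 1) s'| := by
    rw [hp_margS_succ, Finset.mul_sum]
    exact Finset.sum_congr rfl (fun s _ => by ring)
  have h2' : ∑ s, margS rho0 pol nu P h s * (2 * ∑ b, nu h s b *
      |aTil η H Qt h s b - softA η γ H pol r P h s b|) =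
      2 * ∑ s, margS rho0 pol nu P h s * ∑ b, nu h s b *
        |aTil η H Qt h s b - softA η γ H pol r P h s b| := by
    rw [Finset.mul_sum]
    exact Finset.sum_congr rfl (fun s _ => by ring)
  rw [h2, h2'] at h1
  obtain ⟨n, hn⟩ : ∃ n, H - h = n + 1 := ⟨H - h - 1, by omega⟩
  have h3 := mul_le_mul_of_nonneg_left (hU n (h + 1) (by omega)) hγ0
  have h4 := hD h hh
  rw [hn, Finset.sum_range_succ']
  simp only [pow_succ, ← Finset.sum_mul, pow_zero]
  linarith

/-- Part (ii), abstract form. -/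
theorem hp_part2 [Nonempty B] [DecidableEq S] (H : ℕ) (η γ : ℝ) (hη : 0 < η) (hγ0 : 0 ≤ γ)
    (P : ℕ → S → A → B → S → ℝ)
    (hP0 : ∀ h < H, ∀ s a b s', 0 ≤ P h s a b s')
    (hP1 : ∀ h < H, ∀ s a b, ∑ s', P h s a b s' = 1)
    (r : ℕ → S → A → B → ℝ)
    (pol : ℕ → S → B → A → ℝ)
    (hpol0 : ∀ h < H, ∀ s b a, 0 ≤ pol h s b a)
    (hpol1 : ∀ h < H, ∀ s b, ∑ a, pol h s b a = 1)
    (Qt : ℕ → S → B → ℝ) (c : ℝ) (d : ℕ → S → ℝ) (hc : 0 ≤ c) (hd : ∀ l s, 0 ≤ d l s)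
    (he0 : ∀ h < H, ∀ s, epsF η γ H pol r P Qt h s ≤ 0)
    (he : ∀ h < H, ∀ s, epsF η γ H pol r P Qt h s ^ 2 ≤ c * d h s)
    (h : ℕ) (hh : h < H) (s : S) (b : B) :
    (del1 η γ H pol r P Qt h s b) ^ 2 ≤
      2 * ((softQ η γ H pol r P h s b - Qt h s b) -
              ∑ b', qr η γ H pol r P h s b' *
                (softQ η γ H pol r P h s b' - Qt h s b')) ^ 2 +
      2 * γ ^ 2 * c * effH H γ *
        ∑ l ∈ Finset.Ico (h + 1) H, γ ^ (l - h - 1) *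
          ((∑ s', transK pol (qr η γ H pol r P) P h (l - h) s s' * d l s') +
           ∑ s1, pPol pol P h s b s1 *
             ∑ s', transK pol (qr η γ H pol r P) P (h + 1) (l - (h + 1)) s1 s' * d l s') := by
  have heq := hp_del1 η γ hη H pol r P Qt h hh s b
  simp only [hp_uexp η γ hη H pol r P Qt (H - (h + 1)) (h + 1) (by omega), hp_lin] at heq
  set nu := qr η γ H pol r P with hnu
  have nu0 : ∀ h s b, 0 ≤ nu h s b := fun h s b => hp_qr_nonneg η γ H pol r P h s b
  have nu1 : ∀ h < H, ∀ s, ∑ b, nu h s b = 1 := fun h hh s => hp_qr_sum η γ hη H pol r P h hh s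
  have p0 := hp_pPol_nonneg H P hP0 pol hpol0
  have p1 := hp_pPol_one H P hP1 pol hpol1
  have t0 := hp_trans_nonneg H P hP0 pol hpol0 nu nu0
  have t1 := hp_trans_one H P hP1 pol hpol1 nu nu1
  set e := epsF η γ H pol r P Qt with hee
  set X : ℕ → ℝ := fun l => ∑ s1, pPol pol P h s b s1 *
    ∑ s', transK pol nu P (h + 1) (l - (h + 1)) s1 s' * e l s' with hX
  set Y : ℕ → ℝ := fun l => ∑ s', transK pol nu P h (l - h) s s' * e l s' with hY
  have heq2 : ∑ l ∈ Finset.Ico (h + 1) H, γ ^ (l - (h + 1)) * (∑ b', nu h s b' *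
      ∑ s1, pPol pol P h s b' s1 *
        ∑ s', transK pol nu P (h + 1) (l - (h + 1)) s1 s' * e l s') =
      ∑ l ∈ Finset.Ico (h + 1) H, γ ^ (l - (h + 1)) * Y l := by
    refine Finset.sum_congr rfl (fun l hl => ?_)
    rw [Finset.mem_Ico] at hl
    simp only [hY]
    rw [show l - h = (l - (h + 1)) + 1 by omega, hp_trans_first]
  rw [heq2, ← Finset.sum_sub_distrib] at heq
  simp only [← mul_sub] at heq
  have hXY : ∀ l ∈ Finset.Ico (h + 1) H, (X l - Y l) ^ 2 ≤
      c * ((∑ s', transK pol nu P h (l - h) s s' * d l s') +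
           ∑ s1, pPol pol P h s b s1 *
             ∑ s', transK pol nu P (h + 1) (l - (h + 1)) s1 s' * d l s') := by
    intro l hl
    rw [Finset.mem_Ico] at hl
    have tsq : ∀ h0 k s, h0 + k ≤ H →
        (∑ s', transK pol nu P h0 k s s' * e l s') ^ 2 ≤
        c * ∑ s', transK pol nu P h0 k s s' * d l s' := by
      intro h0 k s hk
      refine (hp_jensen _ _ (t0 h0 k hk s) (t1 h0 k hk s)).trans ?_
      rw [Finset.mul_sum]
      refine Finset.sum_le_sum (fun s' _ => ?_)
      have := mul_le_mul_of_nonneg_left (he l hl.2 s') (t0 h0 k hk s s')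
      linarith
    have tneg : ∀ h0 k s, h0 + k ≤ H → ∑ s', transK pol nu P h0 k s s' * e l s' ≤ 0 :=
      fun h0 k s hk => Finset.sum_nonpos (fun s' _ =>
        mul_nonpos_of_nonneg_of_nonpos (t0 h0 k hk s s') (he0 l hl.2 s'))
    have hYn : Y l ≤ 0 := tneg _ _ _ (by omega)
    have hXn : X l ≤ 0 := Finset.sum_nonpos (fun s1 _ =>
      mul_nonpos_of_nonneg_of_nonpos (p0 h hh s b s1) (tneg _ _ _ (by omega)))
    have hY2 := tsq h (l - h) s (by omega)
    have hX2 : X l ^ 2 ≤ c * ∑ s1, pPol pol P h s b s1 *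
             ∑ s', transK pol nu P (h + 1) (l - (h + 1)) s1 s' * d l s' := by
      refine (hp_jensen _ _ (p0 h hh s b) (p1 h hh s b)).trans ?_
      rw [Finset.mul_sum]
      refine Finset.sum_le_sum (fun s1 _ => ?_)
      have := mul_le_mul_of_nonneg_left (tsq (h + 1) (l - (h + 1)) s1 (by omega)) (p0 h hh s b s1)
      linarith
    change Y l ^ 2 ≤ _ at hY2
    nlinarith [mul_nonneg_of_nonpos_of_nonpos hXn hYn]
  have cs := hp_cs (Finset.Ico (h + 1) H) (fun l => γ ^ (l - (h + 1))) (fun l => X l - Y l)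
    (fun l => pow_nonneg hγ0 _)
  have hsum := Finset.sum_le_sum (fun l hl =>
    mul_le_mul_of_nonneg_left (hXY l hl) (pow_nonneg hγ0 (l - (h + 1))))
  have heff : ∑ l ∈ Finset.Ico (h + 1) H, γ ^ (l - (h + 1)) ≤ effH H γ := by
    rw [Finset.sum_Ico_eq_sum_range, effH]
    simp only [Nat.add_sub_cancel_left]
    exact Finset.sum_le_sum_of_subset_of_nonneg
      (Finset.range_mono (Nat.sub_le _ _)) (fun i _ _ => pow_nonneg hγ0 i)
  have hR : ∑ l ∈ Finset.Ico (h + 1) H, γ ^ (l - (h + 1)) *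
      (c * ((∑ s', transK pol nu P h (l - h) s s' * d l s') +
           ∑ s1, pPol pol P h s b s1 *
             ∑ s', transK pol nu P (h + 1) (l - (h + 1)) s1 s' * d l s')) =
      c * ∑ l ∈ Finset.Ico (h + 1) H, γ ^ (l - h - 1) *
          ((∑ s', transK pol nu P h (l - h) s s' * d l s') +
           ∑ s1, pPol pol P h s b s1 *
             ∑ s', transK pol nu P (h + 1) (l - (h + 1)) s1 s' * d l s') := by
    rw [Finset.mul_sum]
    refine Finset.sum_congr rfl (fun l _ => ?_)
    rw [show l - h - 1 = l - (h + 1) by omega]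
    ring
  rw [hR] at hsum
  set R := ∑ l ∈ Finset.Ico (h + 1) H, γ ^ (l - h - 1) *
          ((∑ s', transK pol nu P h (l - h) s s' * d l s') +
           ∑ s1, pPol pol P h s b s1 *
             ∑ s', transK pol nu P (h + 1) (l - (h + 1)) s1 s' * d l s') with hRdef
  have hleft0 : 0 ≤ ∑ l ∈ Finset.Ico (h + 1) H, γ ^ (l - (h + 1)) * (X l - Y l) ^ 2 :=
    Finset.sum_nonneg (fun l _ => mul_nonneg (pow_nonneg hγ0 _) (sq_nonneg _))
  have heff0 : 0 ≤ effH H γ := Finset.sum_nonneg (fun i _ => pow_nonneg hγ0 i)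
  set Z := ∑ l ∈ Finset.Ico (h + 1) H, γ ^ (l - (h + 1)) * (X l - Y l) with hZ
  have hZ2 : Z ^ 2 ≤ effH H γ * (c * R) := by
    refine cs.trans ?_
    exact (mul_le_mul_of_nonneg_right heff hleft0).trans (mul_le_mul_of_nonneg_left hsum heff0)
  have hneg : (softQ η γ H pol r P h s b - Qt h s b) -
      ∑ b', nu h s b' * (softQ η γ H pol r P h s b' - Qt h s b') =
      -((Qt h s b - softQ η γ H pol r P h s b) -
      ∑ b', nu h s b' * (Qt h s b' - softQ η γ H pol r P h s b')) := by
    simp only [mul_sub, Finset.sum_sub_distrib]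
    ring
  rw [hneg, heq]
  set a := (Qt h s b - softQ η γ H pol r P h s b) -
      ∑ b', nu h s b' * (Qt h s b' - softQ η γ H pol r P h s b') with ha
  change (a + γ * Z) ^ 2 ≤ _
  have := mul_le_mul_of_nonneg_left hZ2 (sq_nonneg γ)
  nlinarith [sq_nonneg (a - γ * Z)]

end core
end QSE


/-- Bounding the first-order quantal-response error (steps 0-based).  With `ν = ν^π`:
(i) `E^{π,ν}[|Δ̃_h⁽¹⁾(s_h,b_h)|] ≤ 6(η⁻¹ + 2B_A) eff_H(γ) max_{h'} E^{π,ν}[D_TV(ν_{h'},ν̃_{h'})]`;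
(ii) `(Δ̃_h⁽¹⁾(s,b))² ≤ 2((Q_h^π − Q̃_h)(s,b) − Σ_{b'}ν_h(b'|s)(Q_h^π − Q̃_h)(s,b'))²
+ 16γ²(η⁻¹+2B_A)² eff_H(γ) Σ_{l>h} γ^{l−h−1}(E_s[D_H²(ν_l,ν̃_l)] + E_{s,b}[D_H²(ν_l,ν̃_l)])`. -/
theorem first_order_qre_bound
    {S A B : Type} [Fintype S] [Fintype A] [Fintype B] [DecidableEq S]
    [Nonempty S] [Nonempty A] [Nonempty B]
    (H : ℕ) (hH : 1 ≤ H) (η γ : ℝ) (hη : 0 < η) (hγ0 : 0 ≤ γ) (hγ1 : γ ≤ 1)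
    (rho0 : S → ℝ) (hrho0 : ∀ s, 0 ≤ rho0 s) (hrho1 : ∑ s, rho0 s = 1)
    (P : ℕ → S → A → B → S → ℝ)
    (hP0 : ∀ h < H, ∀ s a b s', 0 ≤ P h s a b s')
    (hP1 : ∀ h < H, ∀ s a b, ∑ s', P h s a b s' = 1)
    (r : ℕ → S → A → B → ℝ) (hr : ∀ h < H, ∀ s a b, r h s a b ∈ Set.Icc (0 : ℝ) 1)
    (pol : ℕ → S → B → A → ℝ)
    (hpol0 : ∀ h < H, ∀ s b a, 0 ≤ pol h s b a)
    (hpol1 : ∀ h < H, ∀ s b, ∑ a, pol h s b a = 1)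
    (Qt : ℕ → S → B → ℝ)
    (BA : ℝ) (hBA : 0 < BA)
    (hA : ∀ h < H, ∀ s b, |softA η γ H pol r P h s b| ≤ BA)
    (hAt : ∀ h < H, ∀ s b, |aTil η H Qt h s b| ≤ BA) :
    ∀ h < H,
      (∑ s, margS rho0 pol (qr η γ H pol r P) P h s *
          ∑ b, qr η γ H pol r P h s b * |del1 η γ H pol r P Qt h s b| ≤
        6 * (η⁻¹ + 2 * BA) * effH H γ *
          (Finset.range H).sup'
            (Finset.nonempty_range_iff.mpr (Nat.one_le_iff_ne_zero.mp hH))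
            (fun h' => ∑ s, margS rho0 pol (qr η γ H pol r P) P h' s *
              ((1 / 2) * ∑ b, |qr η γ H pol r P h' s b - nuTil η H Qt h' s b|))) ∧
      (∀ (s : S) (b : B),
        (del1 η γ H pol r P Qt h s b) ^ 2 ≤
          2 * ((softQ η γ H pol r P h s b - Qt h s b) -
              ∑ b', qr η γ H pol r P h s b' *
                (softQ η γ H pol r P h s b' - Qt h s b')) ^ 2 +
          16 * γ ^ 2 * (η⁻¹ + 2 * BA) ^ 2 * effH H γ *
            ∑ l ∈ Finset.Ico (h + 1) H, γ ^ (l - h - 1) *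
              ((∑ s', transK pol (qr η γ H pol r P) P h (l - h) s s' *
                  ((1 / 2) * ∑ b'', (Real.sqrt (qr η γ H pol r P l s' b'') -
                    Real.sqrt (nuTil η H Qt l s' b'')) ^ 2)) +
               (∑ a, pol h s b a * ∑ s1, P h s a b s1 *
                  ∑ s', transK pol (qr η γ H pol r P) P (h + 1) (l - (h + 1)) s1 s' *
                    ((1 / 2) * ∑ b'', (Real.sqrt (qr η γ H pol r P l s' b'') -
                      Real.sqrt (nuTil η H Qt l s' b'')) ^ 2)))) := by
  have hi : 0 < η⁻¹ := inv_pos.mpr hη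
  have hC : 0 < η⁻¹ + 2 * BA := by linarith
  have ptw : ∀ h < H, ∀ s, ∑ b, qr η γ H pol r P h s b *
      |aTil η H Qt h s b - softA η γ H pol r P h s b| ≤
      (η⁻¹ + 2 * BA) * ∑ b, |qr η γ H pol r P h s b - nuTil η H Qt h s b| := by
    intro h hh s
    rw [Finset.mul_sum]
    exact Finset.sum_le_sum (fun b _ =>
      hp_pointwise η BA _ _ hη (hA h hh s b) (hAt h hh s b))
  have m0 : ∀ h ≤ H, ∀ s, 0 ≤ margS rho0 pol (qr η γ H pol r P) P h s :=
    fun h hh s => hp_marg_nonneg H rho0 hrho0 P hP0 pol hpol0 _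
      (fun h s b => hp_qr_nonneg η γ H pol r P h s b) h hh s
  intro h hh
  constructor
  · set F : ℕ → ℝ := fun h' => ∑ s, margS rho0 pol (qr η γ H pol r P) P h' s *
              ((1 / 2) * ∑ b, |qr η γ H pol r P h' s b - nuTil η H Qt h' s b|) with hF
    set M := (Finset.range H).sup'
            (Finset.nonempty_range_iff.mpr (Nat.one_le_iff_ne_zero.mp hH)) F with hM
    have hFM : ∀ h' < H, F h' ≤ M := fun h' hh' =>
      Finset.le_sup' F (Finset.mem_range.mpr hh')
    have hM0 : 0 ≤ M := le_trans (Finset.sum_nonneg (fun s _ => mul_nonneg (m0 h hh.le s)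
      (mul_nonneg (by norm_num) (Finset.sum_nonneg (fun b _ => abs_nonneg _))))) (hFM h hh)
    have hD : ∀ h < H, ∑ s, margS rho0 pol (qr η γ H pol r P) P h s *
      ∑ b, qr η γ H pol r P h s b *
        |aTil η H Qt h s b - softA η γ H pol r P h s b| ≤ 2 * (η⁻¹ + 2 * BA) * M := by
      intro h hh
      refine le_trans ?_ (mul_le_mul_of_nonneg_left (hFM h hh) (by linarith))
      rw [hF, Finset.mul_sum]
      refine Finset.sum_le_sum (fun s _ => ?_)
      have := mul_le_mul_of_nonneg_left (ptw h hh s) (m0 h hh.le s)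
      linarith
    have h1 := hp_part1 H η γ hη hγ0 rho0 hrho0 P hP0 r pol hpol0 Qt _ hD h hh
    refine h1.trans ?_
    have heff : ∑ i ∈ Finset.range (H - h), γ ^ i ≤ effH H γ :=
      Finset.sum_le_sum_of_subset_of_nonneg
        (Finset.range_mono (Nat.sub_le _ _)) (fun i _ _ => pow_nonneg hγ0 i)
    have heff0 : 0 ≤ effH H γ := Finset.sum_nonneg (fun i _ => pow_nonneg hγ0 i)
    have hCM : 0 ≤ (η⁻¹ + 2 * BA) * M := mul_nonneg hC.le hM0
    have h2 := mul_le_mul_of_nonneg_left heff hCM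
    have h3 := mul_nonneg hCM heff0
    linarith
  · intro s b
    have he0 : ∀ h < H, ∀ s, epsF η γ H pol r P Qt h s ≤ 0 := by
      intro h hh s
      exact hp_kl η hη _ _ (hp_qr_sum η γ hη H pol r P h hh s) (hp_nuTil_sum η hη H Qt h hh s)
    have he : ∀ h < H, ∀ s, epsF η γ H pol r P Qt h s ^ 2 ≤
        (8 * (η⁻¹ + 2 * BA) ^ 2) * ((1 / 2) * ∑ b'', (Real.sqrt (qr η γ H pol r P h s b'') -
                    Real.sqrt (nuTil η H Qt h s b'')) ^ 2) := by
      intro h hh s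
      have h1 := (hp_abs_sum _ (fun b => aTil η H Qt h s b - softA η γ H pol r P h s b)
        (hp_qr_nonneg η γ H pol r P h s)).trans (ptw h hh s)
      have h2 := hp_hell _ (nuTil η H Qt h s) (hp_qr_nonneg η γ H pol r P h s)
        (fun b => (Real.exp_pos _).le : ∀ b, 0 ≤ nuTil η H Qt h s b)
        (hp_qr_sum η γ hη H pol r P h hh s) (hp_nuTil_sum η hη H Qt h hh s)
      have h3 := pow_le_pow_left₀ (abs_nonneg _) h1 2
      rw [sq_abs, mul_pow] at h3
      have h4 := mul_le_mul_of_nonneg_left h2 (sq_nonneg (η⁻¹ + 2 * BA))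
      rw [epsF]
      linarith
    have key := hp_part2 H η γ hη hγ0 P hP0 hP1 r pol hpol0 hpol1 Qt
      (8 * (η⁻¹ + 2 * BA) ^ 2) (fun l s => (1 / 2) *
        ∑ b'', (Real.sqrt (qr η γ H pol r P l s b'') - Real.sqrt (nuTil η H Qt l s b'')) ^ 2)
      (by positivity) (fun l s => by positivity) he0 he h hh s b
    simp only [hp_pPol_sum] at key
    refine key.trans (le_of_eq ?_)
    ring
end
end
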